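/- For every integer m ≥ 1 and every integer g ≥ 2, the counting function b_m^-[g](t) is a quasipolynomial in t of degree m−1 with leading coefficient 1/(m−1)!. -/

import Mathlib

/-- A ruler of length `t` with `m+1` markings: `0 = x 0 < x 1 < ⋯ < x m = t`. -/
def IsRuler (m : ℕ) (t : ℤ) (x : Fin (m + 1) → ℤ) : Prop :=
  StrictMono x ∧ x 0 = 0 ∧ x (Fin.last m) = t

/-- A ruler is a `B_2^-[g]`-set (`g`-Golomb ruler) if every positive integer has at most `g`
representations as a difference `x j - x i` with `i < j`. -/
def IsB2gMinusSet (m g : ℕ) (x : Fin (m + 1) → ℤ) : Prop :=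
  ∀ n : ℤ, 0 < n →
    {p : Fin (m + 1) × Fin (m + 1) | p.1 < p.2 ∧ x p.2 - x p.1 = n}.ncard ≤ g

/-- `b_m^-[g](t)`: the number of `B_2^-[g]`-sets of length `t` with `m+1` markings. -/
noncomputable def bmgMinus (m g : ℕ) (t : ℤ) : ℕ :=
  Nat.card {x : Fin (m + 1) → ℤ // IsRuler m t x ∧ IsB2gMinusSet m g x}


/-- The indicator of a proposition, as a rational number. -/
noncomputable def ratInd (p : Prop) : ℚ := open Classical in if p then 1 else 0

@[simp] lemma ratInd_of {p : Prop} (h : p) : ratInd p = 1 := by simp [ratInd, h]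

@[simp] lemma ratInd_of_not {p : Prop} (h : ¬ p) : ratInd p = 0 := by simp [ratInd, h]

lemma ratInd_and (p q : Prop) : ratInd (p ∧ q) = ratInd p * ratInd q := by
  by_cases p <;> by_cases q <;> simp [*]

lemma ratInd_not (p : Prop) : ratInd (¬ p) = 1 - ratInd p := by
  by_cases p <;> simp [*]

lemma ratInd_forall {ι : Type*} [Fintype ι] (p : ι → Prop) :
    ratInd (∀ i, p i) = ∏ i, ratInd (p i) := by
  by_cases h : ∀ i, p i
  · simp [h]
  · obtain ⟨i, hi⟩ := not_forall.1 h
    rw [ratInd_of_not h, Finset.prod_eq_zero (Finset.mem_univ i) (ratInd_of_not hi)]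

/-- Quasipolynomial functions on `ℤ`. -/
def quasiPoly : Subalgebra ℚ (ℤ → ℚ) where
  carrier := {u | ∃ s : ℕ, 0 < s ∧ ∃ p : ℤ → Polynomial ℚ, ∀ y : ℤ, u y = (p (y % s)).eval (y : ℚ)}
  mul_mem' := by
    rintro u v ⟨s, hs, p, hp⟩ ⟨s', hs', p', hp'⟩
    refine ⟨s * s', by positivity, fun i => p (i % s) * p' (i % s'), fun y => ?_⟩
    simp [hp, hp']
  add_mem' := by
    rintro u v ⟨s, hs, p, hp⟩ ⟨s', hs', p', hp'⟩
    refine ⟨s * s', by positivity, fun i => p (i % s) + p' (i % s'), fun y => ?_⟩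
    simp [hp, hp']
  algebraMap_mem' c := ⟨1, one_pos, fun _ => Polynomial.C c, fun y => by simp⟩

lemma quasiPoly_cast : (fun y : ℤ => (y : ℚ)) ∈ quasiPoly :=
  ⟨1, one_pos, fun _ => Polynomial.X, fun y => by simp⟩

lemma quasiPoly_periodic {u : ℤ → ℚ} {s : ℕ} (hs : 0 < s) (h : ∀ y, u y = u (y % s)) :
    u ∈ quasiPoly :=
  ⟨s, hs, fun i => Polynomial.C (u i), fun y => by simpa using h y⟩

lemma quasiPoly_dvd {s : ℕ} (hs : 0 < s) (r : ℤ) :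
    (fun y : ℤ => ratInd ((s : ℤ) ∣ y - r)) ∈ quasiPoly := by
  refine quasiPoly_periodic hs fun y => congrArg ratInd (propext ?_)
  constructor <;> intro h
  · have := dvd_sub h (Int.dvd_self_sub_emod (x := y) (m := s))
    simpa using this
  · have := dvd_add h (Int.dvd_self_sub_emod (x := y) (m := s))
    simpa using this

lemma eval_mem_subalgebra {X : Type*} (S : Subalgebra ℚ (X → ℚ)) {h : X → ℚ} (hh : h ∈ S)
    (p : Polynomial ℚ) : (fun x => p.eval (h x)) ∈ S := by
  induction p using Polynomial.induction_on' with
  | add p q hp hq =>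
    simp only [Polynomial.eval_add]
    exact S.add_mem hp hq
  | monomial n a =>
    simp only [Polynomial.eval_monomial]
    exact S.smul_mem (S.pow_mem hh n) a

lemma quasiPoly_ediv {s : ℕ} (hs : 0 < s) (r : ℤ) :
    (fun y : ℤ => (((y - r) / s : ℤ) : ℚ)) ∈ quasiPoly := by
  have h1 : (fun y : ℤ => (((y - r) % s : ℤ) : ℚ)) ∈ quasiPoly :=
    quasiPoly_periodic hs fun y => by simp
  have h2 := quasiPoly.smul_mem (quasiPoly.sub_mem (quasiPoly.sub_mem quasiPoly_cast
    (quasiPoly.algebraMap_mem (r : ℚ))) h1) (1 / (s : ℚ))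
  convert h2 using 1
  ext y
  have h3 : ((s * ((y - r) / s) + (y - r) % s : ℤ) : ℚ) = ((y - r : ℤ) : ℚ) :=
    congrArg _ (Int.mul_ediv_add_emod _ _)
  have : (s : ℚ) ≠ 0 := by positivity
  simp only [Pi.smul_apply, Pi.sub_apply, Pi.algebraMap_apply, smul_eq_mul]
  push_cast at h3
  field_simp
  simp
  linarith

lemma exists_polynomial_difference (q : Polynomial ℚ) :
    ∃ H : Polynomial ℚ, ∀ x : ℚ, H.eval x - H.eval (x - 1) = q.eval x := by
  induction q using Polynomial.induction_on' with
  | add p q hp hq =>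
    obtain ⟨H, hH⟩ := hp
    obtain ⟨K, hK⟩ := hq
    exact ⟨H + K, fun x => by simp only [Polynomial.eval_add, ← hH, ← hK]; ring⟩
  | monomial n a =>
    refine ⟨Polynomial.C (a / (n + 1)) * (Polynomial.bernoulli (n + 1)).comp (Polynomial.X + 1),
      fun x => ?_⟩
    have h := Polynomial.bernoulli_eval_one_add (n + 1) x
    have hn : (n + 1 : ℚ) ≠ 0 := by positivity
    simp only [Polynomial.eval_mul, Polynomial.eval_C, Polynomial.eval_comp, Polynomial.eval_add,
      Polynomial.eval_X, Polynomial.eval_one, Polynomial.eval_monomial, sub_add_cancel]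
    rw [add_comm x 1, h]
    push_cast
    field_simp
    simp [mul_assoc]

lemma exists_quasiPoly_difference {u : ℤ → ℚ} (hu : u ∈ quasiPoly) :
    ∃ G ∈ quasiPoly, ∀ y, G y - G (y - 1) = u y := by
  obtain ⟨s, hs, p, hp⟩ := hu
  have hs' : (0 : ℤ) < s := by exact_mod_cast hs
  choose H hH using fun r : ℤ => exists_polynomial_difference
    ((p r).comp (Polynomial.C (s : ℚ) * Polynomial.X + Polynomial.C (r : ℚ)))
  refine ⟨fun y => ∑ r ∈ Finset.Ico (0 : ℤ) s, (H r).eval (((y - r) / s : ℤ) : ℚ), ?_, fun y => ?_⟩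
  · have := quasiPoly.sum_mem (t := Finset.Ico (0 : ℤ) s)
      (f := fun r y => (H r).eval (((y - r) / s : ℤ) : ℚ))
      fun r _ => eval_mem_subalgebra _ (quasiPoly_ediv hs r) (H r)
    convert this using 1
    ext y
    simp
  · rw [← Finset.sum_sub_distrib, Finset.sum_eq_single (y % s)]
    · have h1 : (y - y % s) / s = y / s := by
        rw [Int.ediv_eq_iff_of_pos hs']
        have := Int.mul_ediv_add_emod y s
        constructor <;> nlinarith
      have h2 : (y - 1 - y % s) / s = y / s - 1 := by
        rw [Int.ediv_eq_iff_of_pos hs']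
        have := Int.mul_ediv_add_emod y s
        constructor <;> nlinarith
      rw [h1, h2]
      have h3 := hH (y % s) (y / s : ℤ)
      have h4 : ((s * (y / s) + y % s : ℤ) : ℚ) = (y : ℚ) :=
        congrArg _ (Int.mul_ediv_add_emod _ _)
      push_cast at h3 h4 ⊢
      rw [h3, hp]
      simp [h4]
    · intro r hr hne
      rw [Finset.mem_Ico] at hr
      have h1 : (y - 1 - r) / s = (y - r) / s := by
        rw [Int.ediv_eq_iff_of_pos hs']
        have h2 := Int.mul_ediv_add_emod (y - r) s
        have h3 := Int.emod_lt_of_pos (y - r) hs'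
        have h4 : 0 < (y - r) % s := by
          refine lt_of_le_of_ne (Int.emod_nonneg _ hs'.ne') fun h => hne ?_
          rw [← Int.emod_eq_of_lt hr.1 hr.2]
          exact (Int.emod_eq_emod_iff_emod_sub_eq_zero.2 h.symm).symm
        constructor <;> nlinarith
      rw [h1, sub_self]
    · intro h
      exact absurd (Finset.mem_Ico.2 ⟨Int.emod_nonneg _ hs'.ne', Int.emod_lt_of_pos _ hs'⟩) h

lemma sum_Ioc_of_difference {u G : ℤ → ℚ} (h : ∀ y, G y - G (y - 1) = u y) {a b : ℤ}
    (hab : a ≤ b) : ∑ y ∈ Finset.Ioc a b, u y = G b - G a := by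
  induction b, hab using Int.leInduction with
  | base => simp
  | succ b hb ih =>
    have : Finset.Ioc a (b + 1) = insert (b + 1) (Finset.Ioc a b) := by
      ext y; simp; omega
    rw [this, Finset.sum_insert (by simp), ih, ← h]
    simp

/-- The algebra of piecewise quasipolynomial functions on an abelian group, with pieces cut out by
homogeneous linear inequalities. -/
def piecewiseQuasiPoly (X : Type) [AddCommGroup X] : Subalgebra ℚ (X → ℚ) :=
  Algebra.adjoin ℚ
    ({f | ∃ l : X →+ ℤ, f = fun x => (l x : ℚ)} ∪
      {f | ∃ l : X →+ ℤ, f = fun x => ratInd (0 < l x)} ∪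
      {f | ∃ l : X →+ ℤ, ∃ s : ℕ, 0 < s ∧ ∃ r : ℤ, f = fun x => ratInd ((s : ℤ) ∣ l x - r)})

section

variable {X : Type} [AddCommGroup X]

local notation "𝓐" => piecewiseQuasiPoly

lemma piecewiseQuasiPoly_hom (l : X →+ ℤ) : (fun x => (l x : ℚ)) ∈ 𝓐 X :=
  Algebra.subset_adjoin (Or.inl (Or.inl ⟨l, rfl⟩))

lemma piecewiseQuasiPoly_pos (l : X →+ ℤ) : (fun x => ratInd (0 < l x)) ∈ 𝓐 X :=
  Algebra.subset_adjoin (Or.inl (Or.inr ⟨l, rfl⟩))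

lemma piecewiseQuasiPoly_dvd (l : X →+ ℤ) {s : ℕ} (hs : 0 < s) (r : ℤ) :
    (fun x => ratInd ((s : ℤ) ∣ l x - r)) ∈ 𝓐 X :=
  Algebra.subset_adjoin (Or.inr ⟨l, s, hs, r, rfl⟩)

/-- A predicate whose indicator is piecewise quasipolynomial. -/
def IsPiecewisePred (P : X → Prop) : Prop := (fun x => ratInd (P x)) ∈ 𝓐 X

lemma IsPiecewisePred.congr {P Q : X → Prop} (hP : IsPiecewisePred P) (h : ∀ x, P x ↔ Q x) :
    IsPiecewisePred Q := by
  have : P = Q := funext fun x => propext (h x)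
  rwa [← this]

lemma IsPiecewisePred.not {P : X → Prop} (hP : IsPiecewisePred P) :
    IsPiecewisePred fun x => ¬ P x := by
  simp only [IsPiecewisePred, ratInd_not]
  exact (𝓐 X).sub_mem (𝓐 X).one_mem hP

lemma IsPiecewisePred.and {P Q : X → Prop} (hP : IsPiecewisePred P) (hQ : IsPiecewisePred Q) :
    IsPiecewisePred fun x => P x ∧ Q x := by
  simp only [IsPiecewisePred, ratInd_and]
  exact (𝓐 X).mul_mem hP hQ

lemma IsPiecewisePred.imp {P Q : X → Prop} (hP : IsPiecewisePred P) (hQ : IsPiecewisePred Q) :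
    IsPiecewisePred fun x => P x → Q x :=
  (hP.and hQ.not).not.congr fun x => by tauto

lemma IsPiecewisePred.forall {ι : Type*} [Finite ι] {P : ι → X → Prop}
    (hP : ∀ i, IsPiecewisePred (P i)) : IsPiecewisePred fun x => ∀ i, P i x := by
  cases nonempty_fintype ι
  simp only [IsPiecewisePred, ratInd_forall]
  have := (𝓐 X).prod_mem (t := Finset.univ) fun i _ => hP i
  convert this using 1
  ext x
  simp

lemma isPiecewisePred_const (p : Prop) : IsPiecewisePred fun _ : X => p :=
  (𝓐 X).algebraMap_mem (ratInd p)

lemma isPiecewisePred_lt (l l' : X →+ ℤ) : IsPiecewisePred fun x => l x < l' x :=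
  IsPiecewisePred.congr (piecewiseQuasiPoly_pos (l' - l)) fun x => by simp

lemma isPiecewisePred_le (l l' : X →+ ℤ) : IsPiecewisePred fun x => l x ≤ l' x :=
  (isPiecewisePred_lt l' l).not.congr fun x => by simp

lemma isPiecewisePred_eq (l l' : X →+ ℤ) : IsPiecewisePred fun x => l x = l' x :=
  ((isPiecewisePred_le l l').and (isPiecewisePred_le l' l)).congr fun _ => le_antisymm_iff.symm

lemma piecewiseQuasiPoly_ite {P : X → Prop} (hP : IsPiecewisePred P) {f g h : X → ℚ}
    (hf : f ∈ 𝓐 X) (hg : g ∈ 𝓐 X) (h1 : ∀ x, P x → h x = f x) (h2 : ∀ x, ¬ P x → h x = g x) :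
    h ∈ 𝓐 X := by
  have := (𝓐 X).add_mem ((𝓐 X).mul_mem hP hf) ((𝓐 X).mul_mem hP.not hg)
  convert this using 1
  ext x
  by_cases hx : P x <;> simp [hx, h1, h2]

/-- An integer valued function which, together with the indicators of its residue classes, is
piecewise quasipolynomial. -/
def IsPiecewiseInt (h : X → ℤ) : Prop :=
  (fun x => (h x : ℚ)) ∈ 𝓐 X ∧ ∀ s : ℕ, 0 < s → ∀ r : ℤ, IsPiecewisePred fun x => (s : ℤ) ∣ h x - r

lemma isPiecewiseInt_hom (l : X →+ ℤ) : IsPiecewiseInt fun x => l x :=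
  ⟨piecewiseQuasiPoly_hom l, fun _ hs r => piecewiseQuasiPoly_dvd l hs r⟩

lemma isPiecewiseInt_const (c : ℤ) : IsPiecewiseInt fun _ : X => c :=
  ⟨(𝓐 X).algebraMap_mem (c : ℚ), fun s _ r => isPiecewisePred_const ((s : ℤ) ∣ c - r)⟩

lemma IsPiecewiseInt.sub_const {h : X → ℤ} (hh : IsPiecewiseInt h) (c : ℤ) :
    IsPiecewiseInt fun x => h x - c := by
  refine ⟨?_, fun s hs r => ?_⟩
  · have := (𝓐 X).sub_mem hh.1 ((𝓐 X).algebraMap_mem (c : ℚ))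
    convert this using 1
    ext x
    simp
  · exact (hh.2 s hs (c + r)).congr fun x => by rw [sub_sub]

lemma sum_ratInd_dvd_mul {s : ℕ} (hs : 0 < s) (y : ℤ) (φ : ℤ → ℚ) :
    ∑ i ∈ Finset.Ico (0 : ℤ) s, ratInd ((s : ℤ) ∣ y - i) * φ i = φ (y % s) := by
  have hs' : (0 : ℤ) < s := by exact_mod_cast hs
  rw [Finset.sum_eq_single (y % s)]
  · rw [ratInd_of Int.dvd_self_sub_emod, one_mul]
  · intro i hi hne
    rw [Finset.mem_Ico] at hi
    rw [ratInd_of_not, zero_mul]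
    intro h
    apply hne
    rw [← Int.emod_eq_of_lt hi.1 hi.2]
    exact (Int.emod_eq_emod_iff_emod_sub_eq_zero.2 (Int.emod_eq_zero_of_dvd h)).symm
  · intro h
    exact absurd (Finset.mem_Ico.2 ⟨Int.emod_nonneg _ hs'.ne', Int.emod_lt_of_pos _ hs'⟩) h

lemma IsPiecewiseInt.comp_quasiPoly {h : X → ℤ} (hh : IsPiecewiseInt h) {u : ℤ → ℚ}
    (hu : u ∈ quasiPoly) : (fun x => u (h x)) ∈ 𝓐 X := by
  obtain ⟨s, hs, p, hp⟩ := hu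
  have := (𝓐 X).sum_mem (t := Finset.Ico (0 : ℤ) s) fun i _ =>
    (𝓐 X).mul_mem (hh.2 s hs i) (eval_mem_subalgebra _ hh.1 (p i))
  convert this using 1
  ext x
  rw [Finset.sum_apply, hp]
  exact (sum_ratInd_dvd_mul hs (h x) fun i => (p i).eval (h x : ℚ)).symm

lemma IsPiecewiseInt.ediv {h : X → ℤ} (hh : IsPiecewiseInt h) {B : ℕ} (hB : 0 < B) :
    IsPiecewiseInt fun x => h x / B := by
  have hB' : (0 : ℤ) < B := by exact_mod_cast hB
  refine ⟨?_, fun s hs r => ?_⟩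
  · simpa using hh.comp_quasiPoly (quasiPoly_ediv hB 0)
  · have h1 : (fun y : ℤ => ratInd ((s : ℤ) ∣ y / B - r)) ∈ quasiPoly := by
      refine quasiPoly_periodic (s := B * s) (by positivity) fun y => congrArg ratInd (propext ?_)
      have h2 : y / B = (y % (B * s : ℕ)) / B + s * (y / (B * s : ℕ)) := by
        conv_lhs => rw [← Int.emod_add_mul_ediv y (B * s : ℕ)]
        push_cast
        rw [mul_assoc, Int.add_mul_ediv_left _ _ hB'.ne']
      rw [h2, add_sub_right_comm]
      exact dvd_add_left (dvd_mul_right _ _)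
    exact hh.comp_quasiPoly h1

/-- A family of half-lines (or full lines) whose endpoint is a rational multiple of a linear form. -/
inductive IsHalfLine : (X → ℤ → Prop) → Prop
  | univ : IsHalfLine fun _ _ => True
  | lt (B : ℕ) (hB : 0 < B) (l : X →+ ℤ) : IsHalfLine fun x y => l x < B * y
  | le (B : ℕ) (hB : 0 < B) (l : X →+ ℤ) : IsHalfLine fun x y => l x ≤ B * y

lemma IsHalfLine.exists_subset {P Q : X → ℤ → Prop} (hP : IsHalfLine P) (hQ : IsHalfLine Q) :
    ∃ E : X → Prop, IsPiecewisePred E ∧ (∀ x, E x → ∀ y, P x y → Q x y) ∧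
      ∀ x, ¬ E x → ∀ y, Q x y → P x y := by
  cases hQ with
  | univ => exact ⟨fun _ => True, isPiecewisePred_const _, by simp, by simp⟩
  | lt C hC k =>
    cases hP with
    | univ => exact ⟨fun _ => False, isPiecewisePred_const _, by simp, by simp⟩
    | lt B hB l =>
      refine ⟨fun x => (B • k) x ≤ (C • l) x, isPiecewisePred_le _ _, fun x hx y hy => ?_,
        fun x hx y hy => ?_⟩ <;>
      · simp only [AddMonoidHom.coe_smul, Pi.smul_apply, nsmul_eq_mul] at hx
        zify at hB hC
        nlinarith
    | le B hB l =>
      refine ⟨fun x => (B • k) x < (C • l) x, isPiecewisePred_lt _ _, fun x hx y hy => ?_,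
        fun x hx y hy => ?_⟩ <;>
      · simp only [AddMonoidHom.coe_smul, Pi.smul_apply, nsmul_eq_mul] at hx
        zify at hB hC
        nlinarith
  | le C hC k =>
    cases hP with
    | univ => exact ⟨fun _ => False, isPiecewisePred_const _, by simp, by simp⟩
    | lt B hB l =>
      refine ⟨fun x => (B • k) x ≤ (C • l) x, isPiecewisePred_le _ _, fun x hx y hy => ?_,
        fun x hx y hy => ?_⟩ <;>
      · simp only [AddMonoidHom.coe_smul, Pi.smul_apply, nsmul_eq_mul] at hx
        zify at hB hC
        nlinarith
    | le B hB l =>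
      refine ⟨fun x => (B • k) x ≤ (C • l) x, isPiecewisePred_le _ _, fun x hx y hy => ?_,
        fun x hx y hy => ?_⟩ <;>
      · simp only [AddMonoidHom.coe_smul, Pi.smul_apply, nsmul_eq_mul] at hx
        zify at hB hC
        nlinarith

lemma IsHalfLine.comp_hom {P : X → ℤ → Prop} (hP : IsHalfLine P) (k : X →+ ℤ) :
    IsPiecewisePred fun x => P x (k x) := by
  cases hP with
  | univ => exact isPiecewisePred_const _
  | lt B hB l => exact (isPiecewisePred_lt l (B • k)).congr fun x => by simp
  | le B hB l => exact (isPiecewisePred_le l (B • k)).congr fun x => by simp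

lemma IsHalfLine.exists_endpoint {P : X → ℤ → Prop} (hP : IsHalfLine P) :
    ∃ a : X → ℤ, IsPiecewiseInt a ∧ ∀ x y, 0 ≤ y → (P x y ↔ a x < y) := by
  cases hP with
  | univ => exact ⟨fun _ => -1, isPiecewiseInt_const _, fun x y hy => by simp; omega⟩
  | lt B hB l =>
    refine ⟨_, (isPiecewiseInt_hom l).ediv hB, fun x y _ => ?_⟩
    rw [Int.ediv_lt_iff_lt_mul (by exact_mod_cast hB), mul_comm]
  | le B hB l =>
    refine ⟨_, ((isPiecewiseInt_hom l).sub_const 1).ediv hB, fun x y _ => ?_⟩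
    rw [Int.ediv_lt_iff_lt_mul (by exact_mod_cast hB), mul_comm]
    omega

/-- Products of a piecewise quasipolynomial function of the first variable, a quasipolynomial in
the last variable and the indicator of a half-line. -/
def halfLineProducts (X : Type) [AddCommGroup X] : Set (X × ℤ → ℚ) :=
  {F | ∃ g ∈ 𝓐 X, ∃ u ∈ quasiPoly, ∃ P : X → ℤ → Prop, IsHalfLine P ∧
    F = fun z => g z.1 * u z.2 * ratInd (P z.1 z.2)}

lemma mul_mem_span_halfLineProducts {F G : X × ℤ → ℚ}
    (hF : F ∈ Submodule.span ℚ (halfLineProducts X))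
    (hG : G ∈ Submodule.span ℚ (halfLineProducts X)) :
    F * G ∈ Submodule.span ℚ (halfLineProducts X) := by
  have h := Submodule.mul_mem_mul hF hG
  rw [Submodule.span_mul_span] at h
  refine Submodule.span_le.2 ?_ h
  rintro _ ⟨_, ⟨g, hg, u, hu, P, hP, rfl⟩, _, ⟨g', hg', u', hu', P', hP', rfl⟩, rfl⟩
  obtain ⟨E, hE, h1, h2⟩ := hP.exists_subset hP'
  have h3 := Submodule.add_mem (Submodule.span ℚ (halfLineProducts X))
    (Submodule.subset_span ⟨_, (𝓐 X).mul_mem ((𝓐 X).mul_mem hg hg') hE, _,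
      quasiPoly.mul_mem hu hu', P, hP, rfl⟩)
    (Submodule.subset_span ⟨_, (𝓐 X).mul_mem ((𝓐 X).mul_mem hg hg') hE.not, _,
      quasiPoly.mul_mem hu hu', P', hP', rfl⟩)
  change _ * _ ∈ Submodule.span ℚ (halfLineProducts X)
  convert h3 using 1
  ext ⟨x, y⟩
  simp only [Pi.add_apply, Pi.mul_apply]
  by_cases hx : E x
  · by_cases hy : P x y
    · simp [hx, hy, h1 x hx y hy]; ring
    · simp [hx, hy]
  · by_cases hy : P' x y
    · simp [hx, hy, h2 x hx y hy]; ring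
    · simp [hx, hy]

lemma mem_span_halfLineProducts_fst {g : X → ℚ} (hg : g ∈ 𝓐 X) :
    (fun z => g z.1) ∈ Submodule.span ℚ (halfLineProducts X) :=
  Submodule.subset_span ⟨g, hg, 1, quasiPoly.one_mem, _, .univ, by simp⟩

lemma mem_span_halfLineProducts_snd {u : ℤ → ℚ} (hu : u ∈ quasiPoly) :
    (fun z => u z.2) ∈ Submodule.span ℚ (halfLineProducts X) :=
  Submodule.subset_span ⟨1, (𝓐 X).one_mem, u, hu, _, .univ, by simp⟩

lemma mem_span_halfLineProducts_ratInd {P : X → ℤ → Prop} (hP : IsHalfLine P) :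
    (fun z => ratInd (P z.1 z.2)) ∈ Submodule.span ℚ (halfLineProducts X) :=
  Submodule.subset_span ⟨1, (𝓐 X).one_mem, 1, quasiPoly.one_mem, P, hP, by simp⟩

lemma hom_prod_int_apply (l : X × ℤ →+ ℤ) (x : X) (y : ℤ) :
    l (x, y) = (l.comp (AddMonoidHom.inl X ℤ)) x + l (0, 1) * y := by
  have h1 : ((x, y) : X × ℤ) = (x, 0) + y • (0, 1) := by simp
  rw [h1, map_add, map_zsmul]
  simp [mul_comm]

lemma piecewiseQuasiPoly_le_span {F : X × ℤ → ℚ} (hF : F ∈ 𝓐 (X × ℤ)) :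
    F ∈ Submodule.span ℚ (halfLineProducts X) := by
  have h_one := mem_span_halfLineProducts_fst (𝓐 X).one_mem
  induction hF using Algebra.adjoin_induction with
  | algebraMap c => exact mem_span_halfLineProducts_fst ((𝓐 X).algebraMap_mem c)
  | add F G _ _ hF hG => exact Submodule.add_mem _ hF hG
  | mul F G _ _ hF hG => exact mul_mem_span_halfLineProducts hF hG
  | mem F hF =>
    rcases hF with (⟨l, rfl⟩ | ⟨l, rfl⟩) | ⟨l, s, hs, r, rfl⟩
    · convert Submodule.add_mem _
        (mem_span_halfLineProducts_fst (piecewiseQuasiPoly_hom (l.comp (AddMonoidHom.inl X ℤ))))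
        (Submodule.smul_mem _ (l (0, 1) : ℚ) (mem_span_halfLineProducts_snd quasiPoly_cast)) using 1
      ext ⟨x, y⟩
      simp [hom_prod_int_apply l x y]
    · rcases lt_trichotomy 0 (l (0, 1)) with h | h | h
      · convert mem_span_halfLineProducts_ratInd
          (.lt (l (0, 1)).toNat (by omega) (-l.comp (AddMonoidHom.inl X ℤ))) using 1
        ext ⟨x, y⟩
        refine congrArg ratInd (propext ?_)
        simp only [hom_prod_int_apply l x y, AddMonoidHom.neg_apply, Int.toNat_of_nonneg h.le]
        constructor <;> intro <;> linarith
      · convert mem_span_halfLineProducts_fst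
          (piecewiseQuasiPoly_pos (l.comp (AddMonoidHom.inl X ℤ))) using 1
        ext ⟨x, y⟩
        rw [hom_prod_int_apply l x y, ← h]
        simp
      · convert Submodule.sub_mem _ h_one (mem_span_halfLineProducts_ratInd
          (.le (-l (0, 1)).toNat (by omega) (l.comp (AddMonoidHom.inl X ℤ)))) using 1
        ext ⟨x, y⟩
        rw [Pi.sub_apply, Pi.one_apply, ← ratInd_not]
        refine congrArg ratInd (propext ?_)
        rw [hom_prod_int_apply l x y, Int.toNat_of_nonneg (by omega), not_le]
        constructor <;> intro <;> linarith
    · convert Submodule.sum_mem _ (t := Finset.Ico (0 : ℤ) s) fun i _ =>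
        mul_mem_span_halfLineProducts (mem_span_halfLineProducts_snd (quasiPoly_dvd hs i))
          (mem_span_halfLineProducts_fst (piecewiseQuasiPoly_dvd (l.comp (AddMonoidHom.inl X ℤ)) hs
            (r - l (0, 1) * i))) using 1
      ext ⟨x, y⟩
      simp only [Finset.sum_apply, Pi.mul_apply]
      rw [sum_ratInd_dvd_mul hs y fun i => ratInd ((s : ℤ) ∣
        (l.comp (AddMonoidHom.inl X ℤ)) x - (r - l (0, 1) * i)), hom_prod_int_apply l x y]
      refine congrArg ratInd (propext ((Int.dvd_iff_dvd_of_dvd_sub ?_)))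
      obtain ⟨c, hc⟩ := Int.dvd_self_sub_emod (x := y) (m := s)
      exact ⟨l (0, 1) * c, by linear_combination l (0, 1) * hc⟩

lemma sum_halfLineProducts_mem {F : X × ℤ → ℚ} (hF : F ∈ halfLineProducts X) (k : X →+ ℤ) :
    (fun x => ∑ y ∈ Finset.Icc 0 (k x), F (x, y)) ∈ 𝓐 X := by
  obtain ⟨g, hg, u, hu, P, hP, rfl⟩ := hF
  obtain ⟨G, hG, hGu⟩ := exists_quasiPoly_difference hu
  obtain ⟨a, ha, haP⟩ := hP.exists_endpoint
  have hGk := (isPiecewiseInt_hom k).comp_quasiPoly hG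
  have h1 := (𝓐 X).sub_mem hGk ((isPiecewiseInt_const (-1)).comp_quasiPoly hG)
  have h2 := (𝓐 X).sub_mem hGk (ha.comp_quasiPoly hG)
  have h4 : (fun x => ∑ y ∈ Finset.Icc 0 (k x), u y * ratInd (P x y)) ∈ 𝓐 X := by
    refine piecewiseQuasiPoly_ite ((isPiecewisePred_le 0 k).and (hP.comp_hom k))
      (f := fun x => G (k x) - G (max (-1) (a x)))
      (g := 0) ?_ (𝓐 X).zero_mem ?_ ?_
    · refine piecewiseQuasiPoly_ite (hP.comp_hom 0) h1 h2 (fun x hx => ?_) fun x hx => ?_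
      · have := (haP x 0 le_rfl).1 hx
        rw [max_eq_left (by omega)]
        rfl
      · have := mt (haP x 0 le_rfl).2 hx
        rw [max_eq_right (by omega)]
        rfl
    · intro x hx
      have hk : 0 ≤ k x := hx.1
      have hak := (haP x _ hk).1 hx.2
      rw [← sum_Ioc_of_difference hGu (by omega)]
      have : Finset.Ioc (max (-1) (a x)) (k x) = (Finset.Icc 0 (k x)).filter fun y => a x < y := by
        ext y
        simp only [Finset.mem_Ioc, Finset.mem_filter, Finset.mem_Icc]
        omega
      rw [this, Finset.sum_filter]
      refine Finset.sum_congr rfl fun y hy => ?_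
      have hy' := haP x y (Finset.mem_Icc.1 hy).1
      split_ifs with hay
      · simp [hy'.2 hay]
      · simp [mt hy'.1 hay]
    · intro x hx
      refine Finset.sum_eq_zero fun y hy => ?_
      rw [Finset.mem_Icc] at hy
      have hk : 0 ≤ k x := hy.1.trans hy.2
      have hak : ¬ P x (k x) := fun h => hx ⟨hk, h⟩
      rw [haP x _ hk] at hak
      have : ¬ P x y := by
        rw [haP x _ hy.1]
        omega
      simp [this]
  convert (𝓐 X).mul_mem hg h4 using 1
  ext x
  simp [Finset.mul_sum, mul_assoc]

lemma piecewiseQuasiPoly_sum_Icc {F : X × ℤ → ℚ} (hF : F ∈ 𝓐 (X × ℤ)) (k : X →+ ℤ) :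
    (fun x => ∑ y ∈ Finset.Icc 0 (k x), F (x, y)) ∈ 𝓐 X := by
  have h := piecewiseQuasiPoly_le_span hF
  clear hF
  induction h using Submodule.span_induction with
  | mem F hF => exact sum_halfLineProducts_mem hF k
  | zero =>
    simp only [Pi.zero_apply, Finset.sum_const_zero]
    exact (𝓐 X).zero_mem
  | add F G _ _ hF hG =>
    simp only [Pi.add_apply, Finset.sum_add_distrib]
    exact (𝓐 X).add_mem hF hG
  | smul c F _ hF =>
    simp only [Pi.smul_apply, ← Finset.smul_sum]
    exact (𝓐 X).smul_mem hF c

lemma piecewiseQuasiPoly_comp {Y : Type} [AddCommGroup Y] {f : Y → ℚ} (hf : f ∈ 𝓐 Y)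
    (φ : X →+ Y) : (fun x => f (φ x)) ∈ 𝓐 X := by
  induction hf using Algebra.adjoin_induction with
  | algebraMap c => exact (𝓐 X).algebraMap_mem c
  | add f g _ _ hf hg => exact (𝓐 X).add_mem hf hg
  | mul f g _ _ hf hg => exact (𝓐 X).mul_mem hf hg
  | mem f hf =>
    rcases hf with (⟨l, rfl⟩ | ⟨l, rfl⟩) | ⟨l, s, hs, r, rfl⟩
    · exact piecewiseQuasiPoly_hom (l.comp φ)
    · exact piecewiseQuasiPoly_pos (l.comp φ)
    · exact piecewiseQuasiPoly_dvd (l.comp φ) hs r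

lemma sum_piFinset_succ (n : ℕ) (s : Finset ℤ) (f : (Fin (n + 1) → ℤ) → ℚ) :
    ∑ y ∈ Fintype.piFinset (fun _ => s), f y =
      ∑ z ∈ s, ∑ y ∈ Fintype.piFinset (fun _ => s), f (Fin.cons z y) := by
  rw [← Finset.sum_product']
  refine Finset.sum_nbij' (fun y => (y 0, Fin.tail y)) (fun z => Fin.cons z.1 z.2) ?_ ?_ ?_ ?_ ?_
  · intro y hy
    simp only [Fintype.mem_piFinset, Finset.mem_product] at hy ⊢
    exact ⟨hy 0, fun i => hy i.succ⟩
  · intro z hz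
    simp only [Fintype.mem_piFinset, Finset.mem_product] at hz ⊢
    exact Fin.cases hz.1 hz.2
  · simp
  · simp
  · simp

lemma piecewiseQuasiPoly_sum_piFinset (n : ℕ) : ∀ {X : Type} [AddCommGroup X]
    {F : X × (Fin n → ℤ) → ℚ} (_ : F ∈ 𝓐 (X × (Fin n → ℤ))) (k : X →+ ℤ),
    (fun x => ∑ y ∈ Fintype.piFinset (fun _ => Finset.Icc 0 (k x)), F (x, y)) ∈ 𝓐 X := by
  induction n with
  | zero =>
    intro X _ F hF k
    convert piecewiseQuasiPoly_comp hF (AddMonoidHom.inl X (Fin 0 → ℤ)) using 2 with x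
    rw [Fintype.piFinset_of_isEmpty, Fintype.sum_unique]
    exact congrArg F (Prod.ext rfl (Subsingleton.elim _ _))
  | succ n ih =>
    intro X _ F hF k
    let φ : (X × ℤ) × (Fin n → ℤ) →+ X × (Fin (n + 1) → ℤ) :=
      AddMonoidHom.mk' (fun z => (z.1.1, Fin.cons z.1.2 z.2)) fun a b => by
        refine Prod.ext rfl (funext (Fin.cases ?_ fun i => ?_)) <;> simp
    have h := piecewiseQuasiPoly_sum_Icc
      (ih (piecewiseQuasiPoly_comp hF φ) (k.comp (AddMonoidHom.fst X ℤ))) k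
    simp only [sum_piFinset_succ]
    exact h

lemma exists_quasiPoly_eq_of_pos {f : ℤ → ℚ} (hf : f ∈ 𝓐 ℤ) :
    ∃ u ∈ quasiPoly, ∀ t : ℤ, 0 < t → f t = u t := by
  have hl : ∀ (l : ℤ →+ ℤ) (t : ℤ), l t = l 1 * t := fun l t => by
    have := map_zsmul l t 1
    simpa [mul_comm] using this
  induction hf using Algebra.adjoin_induction with
  | algebraMap c => exact ⟨_, quasiPoly.algebraMap_mem c, fun _ _ => rfl⟩
  | add f g _ _ hf hg =>
    obtain ⟨u, hu, h⟩ := hf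
    obtain ⟨v, hv, h'⟩ := hg
    exact ⟨u + v, quasiPoly.add_mem hu hv, fun t ht => by simp [h t ht, h' t ht]⟩
  | mul f g _ _ hf hg =>
    obtain ⟨u, hu, h⟩ := hf
    obtain ⟨v, hv, h'⟩ := hg
    exact ⟨u * v, quasiPoly.mul_mem hu hv, fun t ht => by simp [h t ht, h' t ht]⟩
  | mem f hf =>
    rcases hf with (⟨l, rfl⟩ | ⟨l, rfl⟩) | ⟨l, s, hs, r, rfl⟩
    · refine ⟨_, quasiPoly.smul_mem quasiPoly_cast (l 1 : ℚ), fun t _ => ?_⟩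
      simp [hl l t]
    · refine ⟨_, quasiPoly.algebraMap_mem (ratInd (0 < l 1)), fun t ht => ?_⟩
      refine congrArg ratInd (propext ?_)
      rw [hl l t, mul_pos_iff_of_pos_right ht]
    · refine ⟨_, quasiPoly_periodic hs (u := fun t => ratInd ((s : ℤ) ∣ l t - r)) fun t => ?_,
        fun _ _ => rfl⟩
      refine congrArg ratInd (propext (Int.dvd_iff_dvd_of_dvd_sub ?_))
      obtain ⟨c, hc⟩ := Int.dvd_self_sub_emod (x := t) (m := s)
      exact ⟨l 1 * c, by rw [hl l t, hl l (t % s)]; linear_combination l 1 * hc⟩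

end

lemma isB2gMinusSet_iff {m g : ℕ} {x : Fin (m + 1) → ℤ} (hx : StrictMono x) :
    IsB2gMinusSet m g x ↔
      ∀ p : Fin (m + 1) × Fin (m + 1), p.1 < p.2 → ∀ T : Finset (Fin (m + 1) × Fin (m + 1)),
        (∀ q : T, q.1.1 < q.1.2 ∧ x q.1.2 - x q.1.1 = x p.2 - x p.1) → T.card ≤ g := by
  constructor
  · intro h p hp T hT
    refine le_trans ?_ (h (x p.2 - x p.1) (sub_pos.2 (hx hp)))
    rw [← Set.ncard_coe_finset]
    exact Set.ncard_le_ncard (fun q hq => hT ⟨q, hq⟩) (Set.toFinite _)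
  · intro h n hn
    rcases Set.eq_empty_or_nonempty
      {p : Fin (m + 1) × Fin (m + 1) | p.1 < p.2 ∧ x p.2 - x p.1 = n} with h0 | ⟨p, hp, rfl⟩
    · simp [h0]
    · classical
      rw [Set.ncard_eq_toFinset_card']
      exact h p hp _ fun q => by simpa using q.2

/-- The strict ruler and `B_2^-[g]` conditions jointly, with the length as a variable. -/
lemma isPiecewisePred_ruler (m g : ℕ) : IsPiecewisePred fun z : ℤ × (Fin (m + 1) → ℤ) =>
    IsRuler m z.1 z.2 ∧ IsB2gMinusSet m g z.2 := by
  let e (i : Fin (m + 1)) : ℤ × (Fin (m + 1) → ℤ) →+ ℤ :=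
    (Pi.evalAddMonoidHom (fun _ => ℤ) i).comp (AddMonoidHom.snd _ _)
  have h1 : IsPiecewisePred fun z : ℤ × (Fin (m + 1) → ℤ) => IsRuler m z.1 z.2 :=
    (IsPiecewisePred.forall fun i => IsPiecewisePred.forall fun j =>
      (isPiecewisePred_const (i < j)).imp (isPiecewisePred_lt (e i) (e j))).and
    ((isPiecewisePred_eq (e 0) 0).and
      (isPiecewisePred_eq (e (Fin.last m)) (AddMonoidHom.fst _ _)))
  have h2 := h1.and <| IsPiecewisePred.forall fun p : Fin (m + 1) × Fin (m + 1) =>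
    (isPiecewisePred_const (p.1 < p.2)).imp <|
      IsPiecewisePred.forall fun T : Finset (Fin (m + 1) × Fin (m + 1)) =>
        (IsPiecewisePred.forall fun q : T => (isPiecewisePred_const (q.1.1 < q.1.2)).and
          (isPiecewisePred_eq (e q.1.2 - e q.1.1) (e p.2 - e p.1))).imp
        (isPiecewisePred_const (T.card ≤ g))
  refine h2.congr fun z => and_congr_right fun hz => ?_
  rw [isB2gMinusSet_iff hz.1]
  rfl

lemma IsRuler.mem_Icc {m : ℕ} {t : ℤ} {x : Fin (m + 1) → ℤ} (hx : IsRuler m t x)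
    (i : Fin (m + 1)) : x i ∈ Finset.Icc 0 t := by
  obtain ⟨h1, h2, h3⟩ := hx
  rw [Finset.mem_Icc, ← h2, ← h3]
  exact ⟨h1.monotone (Fin.zero_le i), h1.monotone (Fin.le_last i)⟩

lemma bmgMinus_eq_sum (m g : ℕ) (t : ℤ) :
    (bmgMinus m g t : ℚ) = ∑ x ∈ Fintype.piFinset (fun _ : Fin (m + 1) => Finset.Icc 0 t),
      ratInd (IsRuler m t x ∧ IsB2gMinusSet m g x) := by
  classical
  rw [bmgMinus, Nat.subtype_card ((Fintype.piFinset fun _ : Fin (m + 1) => Finset.Icc 0 t).filter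
    fun x => IsRuler m t x ∧ IsB2gMinusSet m g x), Finset.card_filter]
  · push_cast
    exact Finset.sum_congr rfl fun x _ => by unfold ratInd; congr
  intro x
  rw [Finset.mem_filter, and_iff_right_iff_imp, Fintype.mem_piFinset]
  exact fun h => h.1.mem_Icc

lemma exists_quasiPoly_eq_bmgMinus (m g : ℕ) :
    ∃ u ∈ quasiPoly, ∀ t : ℤ, 0 < t → (bmgMinus m g t : ℚ) = u t := by
  refine exists_quasiPoly_eq_of_pos ?_
  simp only [bmgMinus_eq_sum]
  exact piecewiseQuasiPoly_sum_piFinset (m + 1) (isPiecewisePred_ruler m g) (AddMonoidHom.id ℤ)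

lemma finite_setOf_isRuler (m : ℕ) (t : ℤ) : {x | IsRuler m t x}.Finite :=
  (Fintype.piFinset fun _ : Fin (m + 1) => Finset.Icc 0 t).finite_toSet.subset fun x hx => by
    rw [Finset.mem_coe, Fintype.mem_piFinset]
    exact hx.mem_Icc

lemma isRuler_cons_snoc {k : ℕ} {t : ℤ} (ht : 0 < t) {y : Fin k → ℤ} (hy : StrictMono y)
    (h : ∀ i, y i ∈ Finset.Ioo 0 t) :
    IsRuler (k + 1) t (Fin.cons 0 (Fin.snoc y t : Fin (k + 1) → ℤ) : Fin (k + 2) → ℤ) := by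
  simp only [Finset.mem_Ioo] at h
  refine ⟨fun i j hij => ?_, by simp, by rw [← Fin.succ_last]; simp⟩
  induction i using Fin.cases with
  | zero =>
    induction j using Fin.cases with
    | zero => simp at hij
    | succ j =>
      induction j using Fin.lastCases with
      | last => simpa using ht
      | cast j => simpa using (h j).1
  | succ i =>
    induction j using Fin.cases with
    | zero => simp at hij
    | succ j =>
      induction i using Fin.lastCases with
      | last =>
        rw [Fin.succ_lt_succ_iff] at hij
        exact absurd hij (Fin.le_last j).not_gt
      | cast i =>
        induction j using Fin.lastCases with
        | last => simpa using (h i).2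
        | cast j => simpa using hy (by simpa using hij)

lemma ncard_setOf_isRuler (k n : ℕ) :
    {x | IsRuler (k + 1) ((n : ℤ) + 1) x}.ncard = n.choose k := by
  have hc : ((Finset.Ioo (0 : ℤ) (n + 1)).powersetCard k).card = n.choose k := by simp
  rw [← hc, ← Set.ncard_coe_finset]
  have h_inner {x : Fin (k + 2) → ℤ} (hx : IsRuler (k + 1) ((n : ℤ) + 1) x) :
      StrictMono fun i : Fin k => x i.castSucc.succ := fun i j hij => hx.1 (by simpa using hij)
  have h_card {x : Fin (k + 2) → ℤ} (hx : IsRuler (k + 1) ((n : ℤ) + 1) x) :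
      (Finset.univ.image fun i : Fin k => x i.castSucc.succ).card = k := by
    rw [Finset.card_image_of_injective _ (h_inner hx).injective, Finset.card_fin]
  refine Set.ncard_congr (fun x _ => Finset.univ.image fun i : Fin k => x i.castSucc.succ)
    ?_ ?_ ?_
  · intro x hx
    rw [Finset.mem_coe, Finset.mem_powersetCard]
    refine ⟨fun y hy => ?_, h_card hx⟩
    obtain ⟨i, -, rfl⟩ := Finset.mem_image.1 hy
    obtain ⟨h1, h2, h3⟩ := hx
    rw [Finset.mem_Ioo, ← h2, ← h3]
    refine ⟨h1 (Fin.succ_pos _), h1 ?_⟩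
    rw [← Fin.succ_last, Fin.succ_lt_succ_iff]
    exact Fin.castSucc_lt_last i
  · intro x x' hx hx' h
    have h1 := Finset.orderEmbOfFin_unique (h_card hx)
      (fun i => Finset.mem_image_of_mem _ (Finset.mem_univ i)) (h_inner hx)
    have h2 := Finset.orderEmbOfFin_unique (h_card hx)
      (fun i => h ▸ Finset.mem_image_of_mem _ (Finset.mem_univ i)) (h_inner hx')
    ext i
    induction i using Fin.cases with
    | zero => rw [hx.2.1, hx'.2.1]
    | succ i =>
      induction i using Fin.lastCases with
      | last => rw [Fin.succ_last, hx.2.2, hx'.2.2]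
      | cast i => exact (congrFun h1 i).trans (congrFun h2 i).symm
  · intro S hS
    rw [Finset.mem_coe, Finset.mem_powersetCard] at hS
    refine ⟨_, isRuler_cons_snoc (by positivity) (S.orderEmbOfFin hS.2).strictMono
      fun i => hS.1 (S.orderEmbOfFin_mem hS.2 i), ?_⟩
    simp

/-- If two rulers satisfying the same nontrivial difference equation agree away from a suitable
interior marking, they are equal. -/
lemma exists_determined_marking {k : ℕ} {t : ℤ} {p q : Fin (k + 2) × Fin (k + 2)}
    (hp : p.1 < p.2) (hq : q.1 < q.2) (hpq : p.2 < q.2) {z : Fin (k + 2) → ℤ}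
    (hz : IsRuler (k + 1) t z) (hzpq : z p.2 - z p.1 = z q.2 - z q.1) :
    ∃ j : Fin (k + 2), j ≠ 0 ∧ j ≠ Fin.last _ ∧ ∀ x x' : Fin (k + 2) → ℤ,
      x p.2 - x p.1 = x q.2 - x q.1 → x' p.2 - x' p.1 = x' q.2 - x' q.1 →
      (∀ i ≠ j, x i = x' i) → x = x' := by
  obtain ⟨a, b⟩ := p
  obtain ⟨c, d⟩ := q
  simp only at *
  have key : ∀ (j : Fin (k + 2)) (x x' : Fin (k + 2) → ℤ), (∀ i ≠ j, x i = x' i) →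
      x j = x' j → x = x' := fun j x x' h hj => funext fun i => by
    by_cases hi : i = j
    · rw [hi, hj]
    · exact h i hi
  by_cases hd : d = Fin.last _
  · have hac : a ≠ c := by
      rintro rfl
      have := hz.1 hpq
      omega
    have hc0 : c ≠ 0 := by
      rintro rfl
      have h1 := hz.1 hpq
      have h2 := hz.1.monotone (Fin.zero_le a)
      omega
    refine ⟨c, hc0, (hq.trans_le (Fin.le_last d)).ne, fun x x' h h' hxx => key c x x' hxx ?_⟩
    have h1 := hxx a hac
    have h2 := hxx d hq.ne'
    by_cases hbc : b = c
    · subst hbc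
      omega
    · have h3 := hxx b hbc
      omega
  · refine ⟨d, ((Fin.zero_le c).trans_lt hq).ne', hd, fun x x' h h' hxx => key d x x' hxx ?_⟩
    have h1 := hxx a (hp.trans hpq).ne
    have h2 := hxx b hpq.ne
    have h3 := hxx c hq.ne
    omega

lemma ncard_ruler_of_difference_eq {k t : ℕ} {p q : Fin (k + 2) × Fin (k + 2)}
    (hp : p.1 < p.2) (hq : q.1 < q.2) (hpq : p.2 < q.2) :
    {x | IsRuler (k + 1) t x ∧ x p.2 - x p.1 = x q.2 - x q.1}.ncard * (t + 1) ≤ (t + 1) ^ k := by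
  rcases Set.eq_empty_or_nonempty
    {x | IsRuler (k + 1) t x ∧ x p.2 - x p.1 = x q.2 - x q.1} with h0 | ⟨z, hz, hzpq⟩
  · simp [h0]
  obtain ⟨j, hj0, hjl, hj⟩ := exists_determined_marking hp hq hpq hz hzpq
  let S : Finset (Fin (k + 2) → ℤ) := Fintype.piFinset fun i =>
    if i = 0 then {0} else if i = Fin.last _ then {(t : ℤ)} else Finset.Icc 0 (t : ℤ)
  have hS : S.card = (t + 1) ^ k := by
    simp [S, Fintype.card_piFinset, Fin.prod_univ_succ (n := k + 1), Fin.prod_univ_castSucc]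
  have hI : (Set.Icc (0 : ℤ) t).ncard = t + 1 := by
    rw [← Finset.coe_Icc, Set.ncard_coe_finset]
    simp
  rw [← hS, ← Set.ncard_coe_finset S, ← hI, ← Set.ncard_prod]
  refine Set.ncard_le_ncard_of_injOn (fun y => Function.update y.1 j y.2) ?_ ?_ S.finite_toSet
  · rintro ⟨x, c⟩ ⟨⟨hx, -⟩, hc⟩
    rw [Finset.mem_coe, Fintype.mem_piFinset]
    intro i
    by_cases hi : i = j
    · subst hi
      simpa [hj0, hjl] using hc
    · rw [Function.update_of_ne hi]
      split_ifs with h1 h2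
      · simpa [h1] using hx.2.1
      · simpa [h2] using hx.2.2
      · exact hx.mem_Icc i
  · rintro ⟨x, c⟩ ⟨⟨-, hx⟩, -⟩ ⟨x', c'⟩ ⟨⟨-, hx'⟩, -⟩ h
    simp only at h
    have hc := congrFun h j
    simp only [Function.update_self] at hc
    refine Prod.ext (hj x x' hx hx' fun i hi => ?_) hc
    simpa [hi] using congrFun h i

lemma exists_difference_eq_of_not_isB2gMinusSet {m g : ℕ} (hg : 1 ≤ g) {x : Fin (m + 1) → ℤ}
    (hx : StrictMono x) (h : ¬ IsB2gMinusSet m g x) :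
    ∃ p q : Fin (m + 1) × Fin (m + 1), p.1 < p.2 ∧ q.1 < q.2 ∧ p.2 < q.2 ∧
      x p.2 - x p.1 = x q.2 - x q.1 := by
  simp only [IsB2gMinusSet, not_forall, not_le] at h
  obtain ⟨n, -, hn⟩ := h
  obtain ⟨p, q, ⟨hp, hpn⟩, ⟨hq, hqn⟩, hpq⟩ := (Set.one_lt_ncard_iff (Set.toFinite _)).1
    (hg.trans_lt hn)
  rcases lt_trichotomy p.2 q.2 with h | h | h
  · exact ⟨p, q, hp, hq, h, hpn.trans hqn.symm⟩
  · refine absurd (Prod.ext (hx.injective ?_) h) hpq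
    rw [h] at hpn
    omega
  · exact ⟨q, p, hq, hp, h, hqn.trans hpn.symm⟩

lemma ncard_ruler_not_isB2gMinusSet {k g t : ℕ} (hg : 1 ≤ g) :
    {x | IsRuler (k + 1) t x ∧ ¬ IsB2gMinusSet (k + 1) g x}.ncard * (t + 1) ≤
      Fintype.card ((Fin (k + 2) × Fin (k + 2)) × (Fin (k + 2) × Fin (k + 2))) * (t + 1) ^ k := by
  let B (r : (Fin (k + 2) × Fin (k + 2)) × (Fin (k + 2) × Fin (k + 2))) :
      Set (Fin (k + 2) → ℤ) := {x | (r.1.1 < r.1.2 ∧ r.2.1 < r.2.2 ∧ r.1.2 < r.2.2) ∧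
        IsRuler (k + 1) t x ∧ x r.1.2 - x r.1.1 = x r.2.2 - x r.2.1}
  have hB (r) : (B r).ncard * (t + 1) ≤ (t + 1) ^ k := by
    by_cases h : r.1.1 < r.1.2 ∧ r.2.1 < r.2.2 ∧ r.1.2 < r.2.2
    · simpa [B, h] using ncard_ruler_of_difference_eq h.1 h.2.1 h.2.2
    · simp [B, h]
  have h1 : {x | IsRuler (k + 1) t x ∧ ¬ IsB2gMinusSet (k + 1) g x} ⊆
      ⋃ r ∈ (Finset.univ : Finset ((Fin (k + 2) × Fin (k + 2)) × _)), B r := by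
    rintro x ⟨hx, hxg⟩
    obtain ⟨p, q, hp, hq, hpq, h⟩ := exists_difference_eq_of_not_isB2gMinusSet hg hx.1 hxg
    exact Set.mem_biUnion (Finset.mem_univ (p, q)) ⟨⟨hp, hq, hpq⟩, hx, h⟩
  have h2 := (Set.ncard_le_ncard h1 ((finite_setOf_isRuler (k + 1) t).subset fun x hx => by
    obtain ⟨r, -, hr⟩ := Set.mem_iUnion₂.1 hx
    exact hr.2.1)).trans (Finset.set_ncard_biUnion_le _ _)
  calc _ ≤ (∑ r, (B r).ncard) * (t + 1) := Nat.mul_le_mul_right _ h2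
    _ = ∑ r, (B r).ncard * (t + 1) := Finset.sum_mul _ _ _
    _ ≤ ∑ _r, (t + 1) ^ k := Finset.sum_le_sum fun r _ => hB r
    _ = _ := by simp

lemma bmgMinus_add_ncard (k g n : ℕ) :
    bmgMinus (k + 1) g ((n : ℤ) + 1) +
      {x | IsRuler (k + 1) ((n : ℤ) + 1) x ∧ ¬ IsB2gMinusSet (k + 1) g x}.ncard = n.choose k := by
  have h1 : bmgMinus (k + 1) g ((n : ℤ) + 1) =
      {x | IsRuler (k + 1) ((n : ℤ) + 1) x ∧ IsB2gMinusSet (k + 1) g x}.ncard := rfl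
  have hfin := finite_setOf_isRuler (k + 1) ((n : ℤ) + 1)
  rw [h1, ← ncard_setOf_isRuler, ← Set.ncard_union_eq _ (hfin.subset fun x hx => hx.1)
    (hfin.subset fun x hx => hx.1)]
  · congr 1
    ext x
    simp only [Set.mem_union, Set.mem_ofPred_eq]
    tauto
  · exact Set.disjoint_left.2 fun x hx hx' => hx'.2 hx.2

open Filter Topology Asymptotics in
lemma tendsto_bmgMinus_div_pow (k : ℕ) {g : ℕ} (hg : 1 ≤ g) :
    Tendsto (fun t : ℕ => (bmgMinus (k + 1) g t : ℝ) / (t : ℝ) ^ k) atTop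
      (𝓝 (1 / (k.factorial : ℝ))) := by
  rw [← tendsto_add_atTop_iff_nat 1]
  let K : ℕ := Fintype.card ((Fin (k + 2) × Fin (k + 2)) × (Fin (k + 2) × Fin (k + 2)))
  let e (n : ℕ) : ℝ := ({x | IsRuler (k + 1) ((n : ℤ) + 1) x ∧
    ¬ IsB2gMinusSet (k + 1) g x}.ncard : ℝ) / ((n : ℝ) + 1) ^ k
  have h1 : Tendsto (fun n : ℕ => (n.choose k : ℝ) / ((n : ℝ) + 1) ^ k) atTop
      (𝓝 (1 / (k.factorial : ℝ))) := by
    have h2 : Tendsto (fun n : ℕ => (n : ℝ) ^ k / k.factorial / ((n : ℝ) + 1) ^ k) atTop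
        (𝓝 (1 / (k.factorial : ℝ))) := by
      have h3 := ((tendsto_natCast_div_add_atTop (1 : ℝ)).pow k).div_const (k.factorial : ℝ)
      rw [one_pow] at h3
      refine h3.congr fun n => ?_
      rw [div_pow, div_right_comm]
    exact ((isEquivalent_choose k).div IsEquivalent.refl).symm.tendsto_nhds h2
  have h2 : Tendsto e atTop (𝓝 0) := by
    refine squeeze_zero (g := fun n : ℕ => K * 2 ^ k * (1 / ((n : ℝ) + 1)))
      (fun n => by positivity) (fun n => ?_) ?_
    · have h3 : (({x | IsRuler (k + 1) ((n : ℤ) + 1) x ∧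
          ¬ IsB2gMinusSet (k + 1) g x}.ncard : ℝ)) * ((n : ℝ) + 1 + 1) ≤
            K * ((n : ℝ) + 1 + 1) ^ k := by
        exact_mod_cast ncard_ruler_not_isB2gMinusSet (k := k) (t := n + 1) hg
      have h4 : ((n : ℝ) + 1 + 1) ^ k ≤ (2 * ((n : ℝ) + 1)) ^ k :=
        pow_le_pow_left₀ (by positivity) (by linarith) k
      rw [mul_pow] at h4
      have h5 := h3.trans (mul_le_mul_of_nonneg_left h4 (by positivity))
      simp only [e]
      rw [div_le_iff₀ (by positivity), mul_one_div, div_mul_eq_mul_div, le_div_iff₀ (by positivity)]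
      refine le_trans (mul_le_mul_of_nonneg_left ?_ (by positivity)) (h5.trans_eq ?_)
      · linarith
      · ring
    · simpa using tendsto_one_div_add_atTop_nhds_zero_nat.const_mul ((K : ℝ) * 2 ^ k)
  have h3 := h1.sub h2
  rw [sub_zero] at h3
  refine h3.congr fun n => ?_
  rw [← bmgMinus_add_ncard k g n]
  simp only [e]
  push_cast
  ring

open Filter Topology in
lemma natDegree_and_leadingCoeff_of_tendsto {p : Polynomial ℝ} {k : ℕ} {c : ℝ} (hc : c ≠ 0)
    {v : ℕ → ℝ} (hv : Tendsto v atTop atTop)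
    (h : Tendsto (fun n => p.eval (v n) / v n ^ k) atTop (𝓝 c)) :
    p.natDegree = k ∧ p.leadingCoeff = c := by
  have hX : (Polynomial.X ^ k : Polynomial ℝ) ≠ 0 := pow_ne_zero _ Polynomial.X_ne_zero
  have h' : Tendsto ((fun x => p.eval x / (Polynomial.X ^ k : Polynomial ℝ).eval x) ∘ v) atTop
      (𝓝 c) := by simpa [Function.comp_def] using h
  rcases lt_trichotomy p.degree (Polynomial.X ^ k : Polynomial ℝ).degree with hd | hd | hd
  · exact absurd (tendsto_nhds_unique h'
      ((p.div_tendsto_atTop_zero_of_degree_lt _ hd).comp hv)) hc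
  · refine ⟨by simpa using Polynomial.natDegree_eq_of_degree_eq hd, ?_⟩
    simpa using tendsto_nhds_unique
      ((p.div_tendsto_atTop_leadingCoeff_div_of_degree_eq _ hd).comp hv) h'
  · exact absurd h'.abs
      (not_tendsto_nhds_of_tendsto_atTop
        ((p.abs_div_tendsto_atTop_atTop_of_degree_gt _ hd hX).comp hv) _)

/-- `b_m^-[g]` is a quasipolynomial in `t` of degree `m-1` with leading coefficient
`1/(m-1)!`. -/
theorem bmgMinus_quasipolynomial (m g : ℕ) (hm : 1 ≤ m) (hg : 2 ≤ g) :
    ∃ s : ℕ, 0 < s ∧ ∃ p : ℕ → Polynomial ℚ,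
      (∀ i < s, (p i).natDegree = m - 1 ∧
        (p i).leadingCoeff = 1 / (Nat.factorial (m - 1) : ℚ)) ∧
      ∀ t : ℕ, 0 < t → (bmgMinus m g (t : ℤ) : ℚ) = (p (t % s)).eval (t : ℚ) := by
  obtain ⟨k, rfl⟩ : ∃ k, m = k + 1 := ⟨m - 1, by omega⟩
  obtain ⟨u, ⟨s, hs, p, hp⟩, hu⟩ := exists_quasiPoly_eq_bmgMinus (k + 1) g
  refine ⟨s, hs, fun i => p i, fun i hi => ?_, fun t ht => ?_⟩
  · have hv : Filter.Tendsto (fun n : ℕ => s * (n + 1) + i) Filter.atTop Filter.atTop :=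
      Filter.tendsto_atTop_mono (fun n => by simp only [id]; nlinarith) Filter.tendsto_id
    have h1 := (tendsto_bmgMinus_div_pow k (by omega : 1 ≤ g)).comp hv
    have h2 := natDegree_and_leadingCoeff_of_tendsto (k := k) (p := (p i).map (algebraMap ℚ ℝ))
      (by positivity) (tendsto_natCast_atTop_atTop.comp hv) (h1.congr fun n => ?_)
    · rw [Polynomial.natDegree_map, Polynomial.leadingCoeff_map] at h2
      refine ⟨h2.1, ?_⟩
      have h3 := h2.2
      rw [eq_ratCast] at h3
      refine Rat.cast_injective (α := ℝ) ?_
      simpa using h3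
    · have h3 := hu ((s * (n + 1) + i : ℕ) : ℤ) (by positivity)
      have h4 : ((s * (n + 1) + i : ℕ) : ℤ) % s = i := by
        rw [← Int.natCast_mod, Nat.mul_add_mod, Nat.mod_eq_of_lt hi]
      rw [hp, h4] at h3
      have h5 : (bmgMinus (k + 1) g ((s * (n + 1) + i : ℕ) : ℤ) : ℝ) =
          ((p i).map (algebraMap ℚ ℝ)).eval ((s * (n + 1) + i : ℕ) : ℝ) := by
        rw [Polynomial.eval_natCast_map, eq_ratCast]
        exact_mod_cast congrArg (Rat.cast (K := ℝ)) h3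
      simp only [Function.comp_apply, h5]
  · rw [hu t (by exact_mod_cast ht), hp]
    simp
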